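/- Let C be a non-tautological clause, F a formula, and let E' be the formula obtained from env_F(C) ∪ {C} by first removing all tautologies and then successively eliminating, in any order, all the variables occurring in C. Then C is semantically blocked in F if and only if E' is the empty formula. -/

import Mathlib

abbrev Var := ℕ
abbrev Lit := Var × Bool
abbrev Clause := Finset Lit
abbrev Formula := Set Clause

def Lit.compl (l : Lit) : Lit := (l.1, !l.2)

def Clause.isTaut (C : Clause) : Prop := ∃ l ∈ C, Lit.compl l ∈ C

abbrev Assign := Var → Bool

def litSat (τ : Assign) (l : Lit) : Prop := τ l.1 = l.2
def clauseSat (τ : Assign) (C : Clause) : Prop := ∃ l ∈ C, litSat τ l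
def formulaSat (τ : Assign) (F : Formula) : Prop := ∀ C ∈ F, clauseSat τ C
def satisfiable (F : Formula) : Prop := ∃ τ : Assign, formulaSat τ F
def satEquiv (F G : Formula) : Prop := satisfiable F ↔ satisfiable G
def redundant (F : Formula) (C : Clause) : Prop := satEquiv (F \ {C}) (F ∪ {C})

def env (F : Formula) (C : Clause) : Formula := {D ∈ F | ∃ l ∈ D, Lit.compl l ∈ C}
def clauseVars (C : Clause) : Set Var := {v | ∃ l ∈ C, l.1 = v}
def formulaVars (F : Formula) : Set Var := {v | ∃ D ∈ F, ∃ l ∈ D, l.1 = v}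
def extVars (F : Formula) (C : Clause) : Set Var := formulaVars (env F C) \ clauseVars C

def semBlocked (F : Formula) (C : Clause) : Prop :=
  ∀ τ : Assign, formulaSat τ (env F C) →
    ∃ τ' : Assign, formulaSat τ' (env F C ∪ {C}) ∧ ∀ v : Var, v ∉ clauseVars C → τ v = τ' v

def blocksLit (F : Formula) (C : Clause) (l : Lit) : Prop :=
  l ∈ C ∧ ∀ D ∈ F, Lit.compl l ∈ D → Clause.isTaut (C ∪ D.erase (Lit.compl l))
def litBlocked (F : Formula) (C : Clause) : Prop := ∃ l : Lit, blocksLit F C l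

def complSet (L : Finset Lit) : Finset Lit := L.image Lit.compl
def blocksSet (F : Formula) (C : Clause) (L : Finset Lit) : Prop :=
  L.Nonempty ∧ L ⊆ C ∧
    ∀ D ∈ F, (D ∩ complSet L).Nonempty → Clause.isTaut ((C \ L) ∪ complSet L ∪ D)
def setBlocked (F : Formula) (C : Clause) : Prop := ∃ L : Finset Lit, blocksSet F C L

abbrev PAssign := Var → Option Bool
def pdom (σ : PAssign) : Set Var := {v | σ v ≠ none}
def plitSat (σ : PAssign) (l : Lit) : Prop := σ l.1 = some l.2
def pclauseSat (σ : PAssign) (C : Clause) : Prop := ∃ l ∈ C, plitSat σ l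
def pformulaSat (σ : PAssign) (F : Formula) : Prop := ∀ C ∈ F, pclauseSat σ C
def restrictF (F : Formula) (σ : PAssign) : Formula := {D ∈ F | ¬ pclauseSat σ D}
def punion (σ₁ σ₂ : PAssign) : PAssign := fun v => (σ₁ v).orElse (fun _ => σ₂ v)

def superBlocked (F : Formula) (C : Clause) : Prop :=
  ∀ σ : PAssign, pdom σ = extVars F C → setBlocked (restrictF F σ) C

def litClauses (F : Formula) (l : Lit) : Formula := {D ∈ F | l ∈ D}
def resolvents (F : Formula) (x : Var) : Formula :=
  {R | ∃ C ∈ litClauses F (x, true), ∃ D ∈ litClauses F (x, false),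
    R = C.erase (x, true) ∪ D.erase (x, false) ∧ ¬ Clause.isTaut R}
def elimVar (F : Formula) (x : Var) : Formula :=
  (F \ (litClauses F (x, true) ∪ litClauses F (x, false))) ∪ resolvents F x

def asymLit (F : Formula) (C : Clause) (l : Lit) : Prop :=
  ∃ D : Clause, D ⊆ C ∧ insert (Lit.compl l) D ∈ F \ {C}
def asymTaut (F : Formula) (C : Clause) : Prop :=
  ∃ ls : List Lit, Clause.isTaut (C ∪ ls.toFinset) ∧
    ∀ i : Fin ls.length, asymLit F (C ∪ (ls.take i.val).toFinset) (ls.get i)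
def ratPair (F : Formula) (C : Clause) : Prop :=
  asymTaut F C ∨
    ∃ l ∈ C, ∀ D ∈ F, Lit.compl l ∈ D → asymTaut F (C ∪ D.erase (Lit.compl l))

theorem Clause.isTaut.clauseSat {R : Clause} (h : Clause.isTaut R) (τ : Assign) :
    clauseSat τ R := by
  obtain ⟨⟨x, b⟩, h1, h2⟩ := h
  by_cases hb : τ x = b
  · exact ⟨_, h1, hb⟩
  · refine ⟨_, h2, ?_⟩
    simp only [litSat, Lit.compl]
    cases b <;> simpa using hb

theorem Clause.isTaut_of_mem {D : Clause} {x : Var} (h1 : (x, true) ∈ D) (h2 : (x, false) ∈ D) :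
    Clause.isTaut D :=
  ⟨(x, true), h1, h2⟩

theorem exists_not_clauseSat {R : Clause} (h : ¬ Clause.isTaut R) :
    ∃ τ : Assign, ¬ clauseSat τ R := by
  refine ⟨fun v => decide ((v, false) ∈ R), ?_⟩
  rintro ⟨⟨x, b⟩, h1, h2⟩
  cases b
  · simp [litSat, h1] at h2
  · exact h (Clause.isTaut_of_mem h1 (by simpa [litSat] using h2))

theorem clauseSat_congr {D : Clause} {τ τ' : Assign} (h : ∀ l ∈ D, τ l.1 = τ' l.1) :
    clauseSat τ D ↔ clauseSat τ' D := by
  constructor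
  · rintro ⟨l, hl, hs⟩
    exact ⟨l, hl, (h l hl).symm.trans hs⟩
  · rintro ⟨l, hl, hs⟩
    exact ⟨l, hl, (h l hl).trans hs⟩

theorem not_isTaut_of_mem_elimVar {F : Formula} (hF : ∀ D ∈ F, ¬ Clause.isTaut D) (x : Var) :
    ∀ D ∈ elimVar F x, ¬ Clause.isTaut D := by
  rintro D (⟨hD, -⟩ | ⟨-, -, -, -, -, hD⟩)
  · exact hF D hD
  · exact hD

theorem notMem_formulaVars_elimVar_self {F : Formula} (hF : ∀ D ∈ F, ¬ Clause.isTaut D)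
    (x : Var) : x ∉ formulaVars (elimVar F x) := by
  rintro ⟨D, hD, ⟨y, b⟩, hl, rfl⟩
  rcases hD with ⟨hD, hx⟩ | ⟨A, ⟨hA, hxA⟩, B, ⟨hB, hxB⟩, rfl, -⟩
  · cases b
    · exact hx (Or.inr ⟨hD, hl⟩)
    · exact hx (Or.inl ⟨hD, hl⟩)
  · rcases Finset.mem_union.1 hl with h | h <;> rw [Finset.mem_erase] at h <;> cases b
    · exact hF A hA (Clause.isTaut_of_mem hxA h.2)
    · exact h.1 rfl
    · exact h.1 rfl
    · exact hF B hB (Clause.isTaut_of_mem h.2 hxB)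

theorem formulaVars_elimVar_subset (F : Formula) (x : Var) :
    formulaVars (elimVar F x) ⊆ formulaVars F := by
  rintro v ⟨D, hD, l, hl, rfl⟩
  rcases hD with ⟨hD, -⟩ | ⟨A, ⟨hA, -⟩, B, ⟨hB, -⟩, rfl, -⟩
  · exact ⟨D, hD, l, hl, rfl⟩
  · rcases Finset.mem_union.1 hl with h | h
    · exact ⟨A, hA, l, Finset.mem_of_mem_erase h, rfl⟩
    · exact ⟨B, hB, l, Finset.mem_of_mem_erase h, rfl⟩

/-- A literal of `D` made true by setting `x` to `b` is either the literal `(x, b)` itself or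
was already true. -/
theorem clauseSat_update_iff (τ : Assign) (x : Var) (b : Bool) (D : Clause) :
    clauseSat (Function.update τ x b) D ↔ (x, b) ∈ D ∨ ∃ l ∈ D, l.1 ≠ x ∧ litSat τ l := by
  constructor
  · rintro ⟨⟨y, c⟩, hl, hs⟩
    by_cases hy : y = x
    · subst hy
      left
      simp only [litSat, Function.update_self] at hs
      rwa [hs]
    · exact Or.inr ⟨_, hl, hy, by simpa [litSat, Function.update_of_ne hy] using hs⟩
  · rintro (h | ⟨l, hl, hx, hs⟩)
    · exact ⟨_, h, by simp [litSat]⟩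
    · exact ⟨l, hl, by simpa [litSat, Function.update_of_ne hx] using hs⟩

theorem formulaSat_elimVar_iff {F : Formula} (hF : ∀ D ∈ F, ¬ Clause.isTaut D) (x : Var)
    (τ : Assign) :
    formulaSat τ (elimVar F x) ↔ ∃ b, formulaSat (Function.update τ x b) F := by
  constructor
  · intro h
    have key : ∀ b, ¬ formulaSat (Function.update τ x b) F →
        ∃ D ∈ F, (x, !b) ∈ D ∧ ∀ l ∈ D, l ≠ (x, !b) → ¬ litSat τ l := by
      intro b hb
      simp only [formulaSat, not_forall] at hb
      obtain ⟨D, hD, hs⟩ := hb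
      rw [clauseSat_update_iff, not_or] at hs
      obtain ⟨hxb, hs⟩ := hs
      push Not at hs
      have hx : (x, !b) ∈ D := by
        by_contra hnx
        obtain ⟨⟨y, c⟩, hl, hlit⟩ := h D (Or.inl ⟨hD, by
          rintro (⟨-, h'⟩ | ⟨-, h'⟩) <;> cases b <;> simp_all⟩)
        by_cases hy : y = x
        · subst hy
          cases b <;> cases c <;> simp_all
        · exact hs _ hl hy hlit
      refine ⟨D, hD, hx, ?_⟩
      rintro ⟨y, c⟩ hl hne
      by_cases hy : y = x
      · subst hy
        cases b <;> cases c <;> simp_all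
      · exact hs _ hl hy
    by_contra hno
    push Not at hno
    obtain ⟨B, hB, hxB, hsB⟩ := key true (hno true)
    obtain ⟨A, hA, hxA, hsA⟩ := key false (hno false)
    have hR : ¬ clauseSat τ (A.erase (x, true) ∪ B.erase (x, false)) := by
      rintro ⟨l, hl, hs⟩
      rcases Finset.mem_union.1 hl with h' | h' <;> rw [Finset.mem_erase] at h'
      · exact hsA l h'.2 h'.1 hs
      · exact hsB l h'.2 h'.1 hs
    exact hR (h _ (Or.inr ⟨A, ⟨hA, hxA⟩, B, ⟨hB, hxB⟩, rfl, fun ht => hR (ht.clauseSat τ)⟩))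
  · rintro ⟨b, hb⟩ D (⟨hD, hx⟩ | ⟨A, ⟨hA, hxA⟩, B, ⟨hB, hxB⟩, rfl, -⟩)
    · rcases (clauseSat_update_iff τ x b D).1 (hb D hD) with h | ⟨l, hl, -, hs⟩
      · cases b
        · exact (hx (Or.inr ⟨hD, h⟩)).elim
        · exact (hx (Or.inl ⟨hD, h⟩)).elim
      · exact ⟨l, hl, hs⟩
    · cases b
      · rcases (clauseSat_update_iff τ x false A).1 (hb A hA) with h | ⟨l, hl, hne, hs⟩
        · exact (hF A hA (Clause.isTaut_of_mem hxA h)).elim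
        · exact ⟨l, Finset.mem_union_left _
            (Finset.mem_erase.2 ⟨fun h => hne (by rw [h]), hl⟩), hs⟩
      · rcases (clauseSat_update_iff τ x true B).1 (hb B hB) with h | ⟨l, hl, hne, hs⟩
        · exact (hF B hB (Clause.isTaut_of_mem h hxB)).elim
        · exact ⟨l, Finset.mem_union_right _
            (Finset.mem_erase.2 ⟨fun h => hne (by rw [h]), hl⟩), hs⟩

theorem not_isTaut_of_mem_foldl_elimVar (xs : List Var) {F : Formula}
    (hF : ∀ D ∈ F, ¬ Clause.isTaut D) : ∀ D ∈ xs.foldl elimVar F, ¬ Clause.isTaut D := by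
  induction xs generalizing F with
  | nil => exact hF
  | cons x xs ih => exact ih (not_isTaut_of_mem_elimVar hF x)

theorem formulaVars_foldl_elimVar_subset (xs : List Var) (F : Formula) :
    formulaVars (xs.foldl elimVar F) ⊆ formulaVars F := by
  induction xs generalizing F with
  | nil => exact subset_rfl
  | cons x xs ih => exact (ih _).trans (formulaVars_elimVar_subset F x)

theorem notMem_formulaVars_foldl_elimVar {xs : List Var} {F : Formula}
    (hF : ∀ D ∈ F, ¬ Clause.isTaut D) {v : Var} (hv : v ∈ xs) :
    v ∉ formulaVars (xs.foldl elimVar F) := by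
  induction xs generalizing F with
  | nil => simp at hv
  | cons x xs ih =>
    rcases List.mem_cons.1 hv with rfl | hv
    · exact fun h => notMem_formulaVars_elimVar_self hF v
        (formulaVars_foldl_elimVar_subset xs _ h)
    · exact ih (not_isTaut_of_mem_elimVar hF x) hv

theorem formulaSat_foldl_elimVar_iff (xs : List Var) {F : Formula}
    (hF : ∀ D ∈ F, ¬ Clause.isTaut D) (τ : Assign) :
    formulaSat τ (xs.foldl elimVar F) ↔
      ∃ τ' : Assign, formulaSat τ' F ∧ ∀ v ∉ xs, τ v = τ' v := by
  induction xs generalizing F with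
  | nil =>
    constructor
    · exact fun h => ⟨τ, h, fun _ _ => rfl⟩
    · rintro ⟨τ', h, he⟩
      rwa [show τ = τ' from funext fun v => he v (by simp)]
  | cons x xs ih =>
    rw [List.foldl_cons, ih (not_isTaut_of_mem_elimVar hF x)]
    simp only [formulaSat_elimVar_iff hF]
    constructor
    · rintro ⟨τ', ⟨b, hb⟩, he⟩
      refine ⟨_, hb, fun v hv => ?_⟩
      rw [List.mem_cons, not_or] at hv
      rw [Function.update_of_ne hv.1, he v hv.2]
    · rintro ⟨τ', h, he⟩
      refine ⟨Function.update τ' x (τ x), ⟨τ' x, by simpa using h⟩, fun v hv => ?_⟩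
      by_cases hx : v = x
      · subst hx
        simp
      · rw [Function.update_of_ne hx, he v (by simp [hx, hv])]

theorem formulaSat_not_isTaut_iff (τ : Assign) (F : Formula) :
    formulaSat τ {D ∈ F | ¬ Clause.isTaut D} ↔ formulaSat τ F := by
  constructor
  · intro h D hD
    by_cases ht : Clause.isTaut D
    · exact ht.clauseSat τ
    · exact h D ⟨hD, ht⟩
  · exact fun h D hD => h D hD.1

/-- Falsifying a non-tautological clause satisfies its whole resolution environment. -/
theorem exists_formulaSat_env (F : Formula) {C : Clause} (hC : ¬ Clause.isTaut C) (τ : Assign) :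
    ∃ τ' : Assign, formulaSat τ' (env F C) ∧ ∀ v ∉ clauseVars C, τ v = τ' v := by
  classical
  obtain ⟨ρ, hρ⟩ := exists_not_clauseSat hC
  refine ⟨fun v => if v ∈ clauseVars C then ρ v else τ v, ?_, fun v hv => by simp [hv]⟩
  rintro D ⟨-, ⟨x, b⟩, hl, hlC⟩
  refine ⟨_, hl, ?_⟩
  have hx : x ∈ clauseVars C := ⟨_, hlC, rfl⟩
  have hn : ¬ ρ x = !b := fun h => hρ ⟨_, hlC, h⟩
  simpa [litSat, hx] using hn

theorem semBlocked_iff_elim_empty (F : Formula) (C : Clause) (hC : ¬ Clause.isTaut C)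
    (xs : List Var) (hnd : xs.Nodup) (hvars : ∀ v : Var, v ∈ xs ↔ v ∈ clauseVars C) :
    semBlocked F C ↔
      xs.foldl elimVar {D ∈ env F C ∪ {C} | ¬ Clause.isTaut D} = (∅ : Formula) := by
  set G : Formula := {D ∈ env F C ∪ {C} | ¬ Clause.isTaut D} with hGdef
  have hG : ∀ D ∈ G, ¬ Clause.isTaut D := fun D hD => hD.2
  have hsat : ∀ τ : Assign, formulaSat τ (xs.foldl elimVar G) ↔
      ∃ τ' : Assign, formulaSat τ' (env F C ∪ {C}) ∧ ∀ v ∉ clauseVars C, τ v = τ' v := by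
    intro τ
    rw [formulaSat_foldl_elimVar_iff xs hG]
    simp only [hGdef, formulaSat_not_isTaut_iff, hvars]
  constructor
  · intro hb
    refine Set.eq_empty_of_forall_notMem fun R hR => ?_
    obtain ⟨τ, hτ⟩ := exists_not_clauseSat (not_isTaut_of_mem_foldl_elimVar xs hG R hR)
    obtain ⟨ρ, hρ, he⟩ := exists_formulaSat_env F hC τ
    refine hτ ((clauseSat_congr fun l hl => he _ fun hv => ?_).2
      ((hsat ρ).2 (hb ρ hρ) R hR))
    exact notMem_formulaVars_foldl_elimVar hG ((hvars _).2 hv) ⟨R, hR, l, hl, rfl⟩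
  · intro he τ _
    exact (hsat τ).1 (by simp [he, formulaSat])
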